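/- Suppose A_1, …, A_r are stable and A_{r+1}, …, A_k are unstable (1 ≤ r < k). Let ρ_1 = max{‖P_j⁻¹P_i‖ : (i,j) ∈ E(G), i ∈ {1,…,r}}, ρ_2 = max{‖P_j⁻¹P_i‖ : (i,j) ∈ E(G), i ∈ {r+1,…,k}}, λ = min{λ_1, …, λ_r}, μ = max{μ_{r+1}, …, μ_k}. For t ∈ [t_{m−1}, t_m), let N_s(0,t) = #{j ∈ {1,…,m} : σ_j ∈ {1,…,r}} and N_u(0,t) = #{j ∈ {1,…,m} : σ_j ∈ {r+1,…,k}}. Then for every signal σ ∈ S_G(τ, η) there exists a constant C > 0, independent of t and of x_0, such that for all t ≥ 0, ‖x(t)‖ ≤ C · exp( N_s(0,t)(ln ρ_1 − λτ) + N_u(0,t)(ln ρ_2 + μη) ) · ‖x_0‖. -/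

import Mathlib

open Matrix Filter Topology Finset

attribute [local instance] Classical.propDecidable

noncomputable section

/-- The spectral (ℓ² operator) norm of a complex square matrix. -/
def sNorm {n : ℕ} (M : Matrix (Fin n) (Fin n) ℂ) : ℝ :=
  ‖Matrix.toEuclideanCLM (𝕜 := ℂ) M‖

/-- The spectral (ℓ² operator) norm of a real square matrix. -/
def sNormR {n : ℕ} (M : Matrix (Fin n) (Fin n) ℝ) : ℝ :=
  ‖Matrix.toEuclideanCLM (𝕜 := ℝ) M‖

/-- The ordered product `exp(A_{σ_m}(t_m - t_{m-1})) ⋯ exp(A_{σ_1} t_1)` of the switched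
system (0-based: `flow A t v m = exp((t m - t (m-1)) • A (v (m-1))) * ⋯ * exp((t 1 - t 0) • A (v 0))`). -/
def flow {n k : ℕ} (A : Fin k → Matrix (Fin n) (Fin n) ℝ)
    (t : ℕ → ℝ) (v : ℕ → Fin k) : ℕ → Matrix (Fin n) (Fin n) ℝ
  | 0 => 1
  | m + 1 => NormedSpace.exp ((t (m + 1) - t m) • A (v m)) * flow A t v m

/-- Piecewise evaluation: the value `f m` on the interval `[t m, t (m+1))`. -/
def pc {α : Type*} (t : ℕ → ℝ) (f : ℕ → α) (d : α) (s : ℝ) : α :=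
  if h : ∃ m, t m ≤ s ∧ s < t (m + 1) then f h.choose else d

/-- The solution of the switched system `x' = A_{σ(t)} x`, `x(0) = x0`:
for `s ∈ [t m, t (m+1))`, `x(s) = exp((s - t m) • A (v m)) * flow A t v m * x0`. -/
def sol {n k : ℕ} (A : Fin k → Matrix (Fin n) (Fin n) ℝ)
    (t : ℕ → ℝ) (v : ℕ → Fin k) (x0 : EuclideanSpace ℝ (Fin n)) (s : ℝ) :
    EuclideanSpace ℝ (Fin n) :=
  pc t (fun m => Matrix.toEuclideanCLM (𝕜 := ℝ)
    (NormedSpace.exp ((s - t m) • A (v m)) * flow A t v m) x0) 0 s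

/-- A `G`-admissible switching signal: `t 0 = 0`, strictly increasing switching times tending
to infinity, and consecutive vertices joined by edges of `G`.  Here `v m` is the vertex active
on `[t m, t (m+1))` (i.e. `v m = σ_{m+1}` in 1-based notation). -/
def Admissible {k : ℕ} (E : Set (Fin k × Fin k)) (t : ℕ → ℝ) (v : ℕ → Fin k) : Prop :=
  t 0 = 0 ∧ StrictMono t ∧ Tendsto t atTop atTop ∧ ∀ m, (v m, v (m + 1)) ∈ E

/-- A real matrix is stable if all its (complex) eigenvalues have negative real part. -/
def MStable {n : ℕ} (M : Matrix (Fin n) (Fin n) ℝ) : Prop :=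
  ∀ z ∈ spectrum ℂ (M.map (Complex.ofReal)), z.re < 0

/-- A real matrix is unstable if some eigenvalue has positive real part and no eigenvalue has
zero real part. -/
def MUnstable {n : ℕ} (M : Matrix (Fin n) (Fin n) ℝ) : Prop :=
  (∃ z ∈ spectrum ℂ (M.map (Complex.ofReal)), 0 < z.re) ∧
    ∀ z ∈ spectrum ℂ (M.map (Complex.ofReal)), z.re ≠ 0

/-- `a` is the maximum of the real parts of the eigenvalues of `M`. -/
def MaxRe {n : ℕ} (M : Matrix (Fin n) (Fin n) ℝ) (a : ℝ) : Prop :=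
  IsGreatest (Complex.re '' spectrum ℂ (M.map (Complex.ofReal))) a

/-- `M = P D P⁻¹` with `P` invertible and `D` diagonal (diagonalizability over `ℂ`). -/
def Diagonalized {n : ℕ} (M : Matrix (Fin n) (Fin n) ℝ)
    (P D : Matrix (Fin n) (Fin n) ℂ) : Prop :=
  IsUnit P ∧ D.IsDiag ∧ M.map (Complex.ofReal) = P * D * P⁻¹

/-- Asymptotic stability of the switched system for the given signal. -/
def AsympStable {n k : ℕ} (A : Fin k → Matrix (Fin n) (Fin n) ℝ)
    (t : ℕ → ℝ) (v : ℕ → Fin k) : Prop :=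
  ∀ x0 : EuclideanSpace ℝ (Fin n), Tendsto (fun s => ‖sol A t v x0 s‖) atTop (𝓝 0)

/-- Membership in the class `S_G(τ, η)`: dwell time at least `τ` in the stable subsystems
(indices `< r`), flee time at most `η` in the unstable subsystems (indices `≥ r`). -/
def InSG {k : ℕ} (r : ℕ) (τ η : ℝ) (t : ℕ → ℝ) (v : ℕ → Fin k) : Prop :=
  ∀ m, ((v m).1 < r → τ ≤ t (m + 1) - t m) ∧ (r ≤ (v m).1 → t (m + 1) - t m ≤ η)

end

open scoped Matrix.Norms.L2Operator in
lemma sNorm_diag_le {n : ℕ} (d : Fin n → ℂ) (c : ℝ) (hc : 0 ≤ c) (h : ∀ i, ‖d i‖ ≤ c) :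
    sNorm (Matrix.diagonal d) ≤ c := by
  have h1 : sNorm (Matrix.diagonal d) = ‖(Matrix.diagonal d : Matrix (Fin n) (Fin n) ℂ)‖ := rfl
  rw [h1, Matrix.l2_opNorm_diagonal]
  exact (pi_norm_le_iff_of_nonneg hc).2 h

lemma sNorm_mul_le {n : ℕ} (M N : Matrix (Fin n) (Fin n) ℂ) :
    sNorm (M * N) ≤ sNorm M * sNorm N := by
  unfold sNorm
  rw [map_mul]
  exact norm_mul_le _ _

lemma sNorm_nonneg {n : ℕ} (M : Matrix (Fin n) (Fin n) ℂ) : 0 ≤ sNorm M := norm_nonneg _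

lemma sNorm_pos {n : ℕ} [NeZero n] (M : Matrix (Fin n) (Fin n) ℂ) (h : IsUnit M) :
    0 < sNorm M := by
  unfold sNorm
  rw [norm_pos_iff]
  intro h0
  have : M = 0 := by simpa using h0
  subst this
  exact not_isUnit_zero h

lemma real_norm_le {n : ℕ} (M : Matrix (Fin n) (Fin n) ℝ) (x : EuclideanSpace ℝ (Fin n)) :
    ‖Matrix.toEuclideanCLM (𝕜 := ℝ) M x‖ ≤ sNorm (M.map Complex.ofReal) * ‖x‖ := by
  have key : ∀ y : EuclideanSpace ℝ (Fin n),
      ‖(WithLp.toLp 2 (fun i => (y i : ℂ)) : EuclideanSpace ℂ (Fin n))‖ = ‖y‖ := by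
    intro y
    simp [EuclideanSpace.norm_eq]
  rw [← key, ← key x]
  refine le_trans (le_of_eq ?_) (ContinuousLinearMap.le_opNorm _ _)
  congr 1
  ext i
  simp [Matrix.toEuclideanCLM_toLp, Matrix.ofLp_toEuclideanCLM, Matrix.mulVec, dotProduct]

open scoped Matrix.Norms.Operator in
lemma map_exp_ofReal {n : ℕ} (M : Matrix (Fin n) (Fin n) ℝ) :
    (NormedSpace.exp M).map Complex.ofReal = NormedSpace.exp (M.map Complex.ofReal) := by
  have := NormedSpace.map_exp ((Complex.ofRealHom).mapMatrix (m := Fin n))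
    (by
      show Continuous fun M : Matrix (Fin n) (Fin n) ℝ => M.map Complex.ofReal
      exact Continuous.matrix_map continuous_id Complex.continuous_ofReal) M
  exact this

lemma exp_diag {n : ℕ} (M : Matrix (Fin n) (Fin n) ℝ) (P D : Matrix (Fin n) (Fin n) ℂ)
    (h : Diagonalized M P D) (s : ℝ) :
    (NormedSpace.exp (s • M)).map Complex.ofReal
      = P * Matrix.diagonal (fun i => Complex.exp (s * D i i)) * P⁻¹ := by
  obtain ⟨hP, hD, hM⟩ := h
  rw [map_exp_ofReal]
  have h1 : (s • M).map Complex.ofReal = P * Matrix.diagonal (fun i => (s : ℂ) * D i i) * P⁻¹ := by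
    have h2 : (s • M).map Complex.ofReal = (s : ℂ) • M.map Complex.ofReal := by
      ext i j; simp
    have h3 : Matrix.diagonal (fun i => (s : ℂ) * D i i) = (s : ℂ) • D := by
      conv_rhs => rw [← hD.diagonal_diag]
      ext i j
      by_cases hij : i = j
      · subst hij; simp
      · simp [hij]
    rw [h2, h3, hM]; simp
  rw [h1, Matrix.exp_conj _ _ hP, Matrix.exp_diagonal]
  congr 3
  ext i
  rw [Pi.coe_exp, Complex.exp_eq_exp_ℂ]

lemma diag_re_le {n : ℕ} (M : Matrix (Fin n) (Fin n) ℝ) (P D : Matrix (Fin n) (Fin n) ℂ)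
    (h : Diagonalized M P D) (a : ℝ) (ha : MaxRe M a) (i : Fin n) : (D i i).re ≤ a := by
  obtain ⟨hP, hD, hM⟩ := h
  refine ha.2 ⟨D i i, ?_, rfl⟩
  obtain ⟨u, rfl⟩ := hP
  rw [hM, ← Matrix.coe_units_inv, spectrum.units_conjugate, ← hD.diagonal_diag,
    spectrum_diagonal]
  exact ⟨i, by simp⟩

lemma sNorm_expD_le {n : ℕ} (M : Matrix (Fin n) (Fin n) ℝ) (P D : Matrix (Fin n) (Fin n) ℂ)
    (h : Diagonalized M P D) (a : ℝ) (ha : MaxRe M a) (s : ℝ) (hs : 0 ≤ s) :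
    sNorm (Matrix.diagonal (fun i => Complex.exp (s * D i i))) ≤ Real.exp (a * s) := by
  apply sNorm_diag_le _ _ (Real.exp_nonneg _)
  intro i
  rw [Complex.norm_exp]
  apply Real.exp_le_exp.2
  simp only [Complex.mul_re, Complex.ofReal_re, Complex.ofReal_im, zero_mul, sub_zero]
  rw [mul_comm]
  exact mul_le_mul_of_nonneg_right (diag_re_le M P D h a ha i) hs

set_option maxHeartbeats 1000000 in
/-- for every signal in `S_G(τ, η)` there is a constant `C > 0`, independent
of time and of the initial condition, such that for `s ∈ [t m, t (m+1))` (1-based: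
`t ∈ [t_{m-1}, t_m)`),
`‖x(s)‖ ≤ C·exp(N_s(0,s)(ln ρ₁ − λτ) + N_u(0,s)(ln ρ₂ + μη))·‖x_0‖`, where `N_s(0,s)`
(resp. `N_u(0,s)`) is the number of indices `j ∈ {0,…,m}` with `v j` stable (resp.
unstable). -/
theorem growth_estimate_dwell_flee {n k : ℕ} (E : Set (Fin k × Fin k))
    (r : ℕ) (hr : 1 ≤ r) (hrk : r < k)
    (A : Fin k → Matrix (Fin n) (Fin n) ℝ) (P D : Fin k → Matrix (Fin n) (Fin n) ℂ)
    (hdiag : ∀ i, Diagonalized (A i) (P i) (D i))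
    (hstab : ∀ i : Fin k, i.1 < r → MStable (A i))
    (hunst : ∀ i : Fin k, r ≤ i.1 → MUnstable (A i))
    (lam mu : Fin k → ℝ)
    (hlam : ∀ i : Fin k, i.1 < r → MaxRe (A i) (-(lam i)))
    (hmu : ∀ i : Fin k, r ≤ i.1 → MaxRe (A i) (mu i))
    (ρ₁ ρ₂ lmin mumax : ℝ)
    (hρ₁ : IsGreatest
      {x : ℝ | ∃ i j : Fin k, (i, j) ∈ E ∧ i.1 < r ∧ x = sNorm ((P j)⁻¹ * P i)} ρ₁)
    (hρ₂ : IsGreatest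
      {x : ℝ | ∃ i j : Fin k, (i, j) ∈ E ∧ r ≤ i.1 ∧ x = sNorm ((P j)⁻¹ * P i)} ρ₂)
    (hlmin : IsLeast {x : ℝ | ∃ i : Fin k, i.1 < r ∧ x = lam i} lmin)
    (hmumax : IsGreatest {x : ℝ | ∃ i : Fin k, r ≤ i.1 ∧ x = mu i} mumax)
    (τ η : ℝ) (hτ : 0 < τ) (hη : 0 < η)
    (t : ℕ → ℝ) (v : ℕ → Fin k) (hadm : Admissible E t v) (hsg : InSG r τ η t v) :
    ∃ C : ℝ, 0 < C ∧ ∀ (x0 : EuclideanSpace ℝ (Fin n)) (m : ℕ) (s : ℝ),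
      t m ≤ s → s < t (m + 1) →
      ‖sol A t v x0 s‖ ≤ C * Real.exp (
          (((Finset.range (m + 1)).filter (fun j => (v j).1 < r)).card : ℝ) *
            (Real.log ρ₁ - lmin * τ) +
          (((Finset.range (m + 1)).filter (fun j => r ≤ (v j).1)).card : ℝ) *
            (Real.log ρ₂ + mumax * η)) * ‖x0‖ := by
  obtain ⟨ht0, htm, htt, hE⟩ := hadm
  have hstep : ∀ m, 0 ≤ t (m + 1) - t m := fun m => sub_nonneg.2 (htm.monotone (Nat.le_succ m))
  have : NeZero n := by
    constructor
    rintro rfl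
    obtain ⟨z, hz, -⟩ := (hunst ⟨r, hrk⟩ le_rfl).1
    rw [spectrum.mem_iff] at hz
    exact hz (isUnit_of_subsingleton _)
  have hPinv : ∀ i j, IsUnit ((P j)⁻¹ * P i) := fun i j =>
    (Matrix.isUnit_nonsing_inv_iff.2 (hdiag j).1).mul (hdiag i).1
  have hρ₁0 : 0 < ρ₁ := by
    obtain ⟨i, j, -, -, h⟩ := hρ₁.1
    rw [h]; exact sNorm_pos _ (hPinv i j)
  have hρ₂0 : 0 < ρ₂ := by
    obtain ⟨i, j, -, -, h⟩ := hρ₂.1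
    rw [h]; exact sNorm_pos _ (hPinv i j)
  have hlpos : 0 < lmin := by
    obtain ⟨i, hi, h⟩ := hlmin.1
    obtain ⟨z, hz, hz2⟩ := (hlam i hi).1
    have := hstab i hi z hz
    linarith
  have hmpos : 0 < mumax := by
    obtain ⟨i, hi, h⟩ := hmumax.1
    obtain ⟨z, hz, hz2⟩ := (hunst i hi).1
    have := (hmu i hi).2 ⟨z, hz, rfl⟩
    linarith
  -- per-vertex exponent
  set g : Fin k → ℝ := fun i =>
    if i.1 < r then Real.log ρ₁ - lmin * τ else Real.log ρ₂ + mumax * η with hg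
  let X : ℝ → Fin k → Matrix (Fin n) (Fin n) ℂ := fun s i =>
    Matrix.diagonal (fun a => Complex.exp (s * D i a a))
  have hXs : ∀ i : Fin k, i.1 < r → ∀ s, 0 ≤ s → sNorm (X s i) ≤ Real.exp (-(lmin * s)) := by
    intro i hi s hs
    refine (sNorm_expD_le _ _ _ (hdiag i) _ (hlam i hi) s hs).trans (Real.exp_le_exp.2 ?_)
    have : lmin ≤ lam i := hlmin.2 ⟨i, hi, rfl⟩
    nlinarith
  have hXu : ∀ i : Fin k, r ≤ i.1 → ∀ s, 0 ≤ s → sNorm (X s i) ≤ Real.exp (mumax * s) := by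
    intro i hi s hs
    refine (sNorm_expD_le _ _ _ (hdiag i) _ (hmu i hi) s hs).trans (Real.exp_le_exp.2 ?_)
    have : mu i ≤ mumax := hmumax.2 ⟨i, hi, rfl⟩
    nlinarith
  let F : ℕ → Matrix (Fin n) (Fin n) ℂ := fun m =>
    (P (v m))⁻¹ * (flow A t v m).map Complex.ofReal
  have hmapmul : ∀ M N : Matrix (Fin n) (Fin n) ℝ,
      (M * N).map Complex.ofReal = M.map Complex.ofReal * N.map Complex.ofReal := fun M N =>
    map_mul (Complex.ofRealHom.mapMatrix (m := Fin n)) M N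
  have hfl : ∀ m s, (NormedSpace.exp (s • A (v m)) * flow A t v m).map Complex.ofReal
      = P (v m) * (X s (v m) * F m) := by
    intro m s
    rw [hmapmul, exp_diag _ _ _ (hdiag (v m))]
    simp only [X, F, Matrix.mul_assoc]
  have hFs : ∀ m, F (m + 1)
      = ((P (v (m + 1)))⁻¹ * P (v m)) * (X (t (m + 1) - t m) (v m) * F m) := by
    intro m
    have : F (m + 1) = (P (v (m + 1)))⁻¹ *
      (NormedSpace.exp ((t (m + 1) - t m) • A (v m)) * flow A t v m).map Complex.ofReal := rfl
    rw [this, hfl, Matrix.mul_assoc]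
  clear_value X F
  have hone : ∀ m, sNorm ((P (v (m + 1)))⁻¹ * P (v m)) * sNorm (X (t (m + 1) - t m) (v m))
      ≤ Real.exp (g (v m)) := by
    intro m
    by_cases hv : (v m).1 < r
    · have e : Real.exp (g (v m)) = ρ₁ * Real.exp (-(lmin * τ)) := by
        simp only [hg, if_pos hv]
        rw [sub_eq_add_neg, Real.exp_add, Real.exp_log hρ₁0]
      rw [e]
      refine mul_le_mul (hρ₁.2 ⟨_, _, hE m, hv, rfl⟩) ?_ (sNorm_nonneg _) hρ₁0.le
      refine (hXs _ hv _ (hstep m)).trans (Real.exp_le_exp.2 ?_)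
      have := (hsg m).1 hv
      nlinarith
    · have e : Real.exp (g (v m)) = ρ₂ * Real.exp (mumax * η) := by
        simp only [hg, if_neg hv]
        rw [Real.exp_add, Real.exp_log hρ₂0]
      push Not at hv
      rw [e]
      refine mul_le_mul (hρ₂.2 ⟨_, _, hE m, hv, rfl⟩) ?_ (sNorm_nonneg _) hρ₂0.le
      refine (hXu _ hv _ (hstep m)).trans (Real.exp_le_exp.2 ?_)
      have := (hsg m).2 hv
      nlinarith
  have hF : ∀ m, sNorm (F m) ≤ Real.exp (∑ j ∈ Finset.range m, g (v j)) * sNorm (F 0) := by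
    intro m
    induction m with
    | zero => simp
    | succ m ih =>
      rw [hFs, Finset.sum_range_succ, Real.exp_add,
        mul_comm (Real.exp (∑ j ∈ Finset.range m, g (v j)))]
      calc _ ≤ sNorm ((P (v (m + 1)))⁻¹ * P (v m)) * (sNorm (X (t (m + 1) - t m) (v m)) *
              sNorm (F m)) := (sNorm_mul_le _ _).trans
                (mul_le_mul_of_nonneg_left (sNorm_mul_le _ _) (sNorm_nonneg _))
        _ ≤ Real.exp (g (v m)) * sNorm (F m) := by
            rw [← mul_assoc]
            exact mul_le_mul_of_nonneg_right (hone m) (sNorm_nonneg _)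
        _ ≤ _ := by
            rw [mul_assoc]
            exact mul_le_mul_of_nonneg_left ih (Real.exp_nonneg _)
  let K : Fin k → ℝ := fun i => sNorm (P i) * Real.exp (mumax * η) * Real.exp (-(g i))
  have hK : ∀ i, 0 ≤ K i := fun i => mul_nonneg (mul_nonneg (sNorm_nonneg _)
    (Real.exp_nonneg _)) (Real.exp_nonneg _)
  have hKs : 0 ≤ ∑ i, K i := Finset.sum_nonneg fun i _ => hK i
  refine ⟨(∑ i, K i) * sNorm (F 0) + 1, by
    have := mul_nonneg hKs (sNorm_nonneg (F 0)); linarith, ?_⟩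
  intro x0 m s hs1 hs2
  have hexp : (((Finset.range (m + 1)).filter (fun j => (v j).1 < r)).card : ℝ) *
            (Real.log ρ₁ - lmin * τ) +
          (((Finset.range (m + 1)).filter (fun j => r ≤ (v j).1)).card : ℝ) *
            (Real.log ρ₂ + mumax * η) = ∑ j ∈ Finset.range (m + 1), g (v j) := by
    simp only [hg]
    rw [Finset.sum_ite, Finset.sum_const, Finset.sum_const, nsmul_eq_mul, nsmul_eq_mul]
    simp only [not_lt]
  rw [hexp]
  have hsol : sol A t v x0 s = Matrix.toEuclideanCLM (𝕜 := ℝ)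
      (NormedSpace.exp ((s - t m) • A (v m)) * flow A t v m) x0 := by
    unfold sol pc
    have hex : ∃ m, t m ≤ s ∧ s < t (m + 1) := ⟨m, hs1, hs2⟩
    rw [dif_pos hex]
    have hch : hex.choose = m := by
      obtain ⟨h1, h2⟩ := hex.choose_spec
      have a1 := htm.lt_iff_lt.1 (h1.trans_lt hs2)
      have a2 := htm.lt_iff_lt.1 (hs1.trans_lt h2)
      omega
    rw [hch]
  rw [hsol]
  refine (real_norm_le _ _).trans (mul_le_mul_of_nonneg_right ?_ (norm_nonneg _))
  rw [hfl]
  have hXb : sNorm (X (s - t m) (v m)) ≤ Real.exp (mumax * η) := by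
    by_cases hv : (v m).1 < r
    · refine (hXs _ hv _ (sub_nonneg.2 hs1)).trans (Real.exp_le_exp.2 ?_)
      have := mul_nonneg hlpos.le (sub_nonneg.2 hs1)
      have := mul_pos hmpos hη
      linarith
    · push Not at hv
      refine (hXu _ hv _ (sub_nonneg.2 hs1)).trans (Real.exp_le_exp.2 ?_)
      have := (hsg m).2 hv
      exact mul_le_mul_of_nonneg_left (by linarith) hmpos.le
  calc _ ≤ sNorm (P (v m)) * (sNorm (X (s - t m) (v m)) * sNorm (F m)) :=
        (sNorm_mul_le _ _).trans
          (mul_le_mul_of_nonneg_left (sNorm_mul_le _ _) (sNorm_nonneg _))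
    _ ≤ sNorm (P (v m)) * (Real.exp (mumax * η) *
          (Real.exp (∑ j ∈ Finset.range m, g (v j)) * sNorm (F 0))) :=
        mul_le_mul_of_nonneg_left (mul_le_mul hXb (hF m) (sNorm_nonneg _) (Real.exp_nonneg _))
          (sNorm_nonneg _)
    _ = K (v m) * sNorm (F 0) * Real.exp (∑ j ∈ Finset.range (m + 1), g (v j)) := by
        rw [Finset.sum_range_succ, Real.exp_add]
        simp only [K]
        have : Real.exp (-(g (v m))) * Real.exp (g (v m)) = 1 := by
          rw [← Real.exp_add]; simp
        linear_combination (-(sNorm (P (v m)) * Real.exp (mumax * η) *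
          Real.exp (∑ j ∈ Finset.range m, g (v j)) * sNorm (F 0))) * this
    _ ≤ _ := by
        refine mul_le_mul_of_nonneg_right ?_ (Real.exp_nonneg _)
        have h1 : K (v m) ≤ ∑ i, K i :=
          Finset.single_le_sum (fun i _ => hK i) (Finset.mem_univ _)
        have := mul_le_mul_of_nonneg_right h1 (sNorm_nonneg (F 0))
        linarith
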